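/- Let d ≥ 1, p > 1 and L₀ ≥ 2. There is a constant C = C(d,p) such that for every Lipschitz function u : ℝ^d → ℝ with |u| ≤ 1 on B₁ and ‖∇u‖_{L^∞(B₁)} ≤ L₀, one has ∬_{B₁×B₁} |u(x)−u(y)|^p / |x−y|^{d+1} dx dy ≤ C · log(L₀) · ∫_{B₁} |∇u(x)| dx. -/

import Mathlib

open MeasureTheory Metric Set

lemma aux_line {d : ℕ} (v : EuclideanSpace ℝ (Fin d) → ℝ) {K : NNReal} (hv : LipschitzWith K v)
    (h : EuclideanSpace ℝ (Fin d)) :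
    ∀ᵐ x : EuclideanSpace ℝ (Fin d), ‖v (x + h) - v x‖ₑ ≤
      ∫⁻ t in Ioc (0:ℝ) 1, ‖fderiv ℝ v (x + t • h)‖ₑ * ‖h‖ₑ := by
  have h1 : ∀ᵐ x : EuclideanSpace ℝ (Fin d), ∀ᵐ t : ℝ, DifferentiableAt ℝ v (x + t • h) := by
    rw [Measure.ae_ae_comm]
    · refine Filter.Eventually.of_forall fun t => ?_
      exact (measurePreserving_add_right volume (t • h)).quasiMeasurePreserving.ae
        hv.ae_differentiableAt
    · have := measurableSet_of_differentiableAt ℝ v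
      have hm : Measurable (fun q : EuclideanSpace ℝ (Fin d) × ℝ => q.1 + q.2 • h) := by fun_prop
      exact hm this
  filter_upwards [h1] with x hx
  set g : ℝ → ℝ := fun t => v (x + t • h) with hg
  have hgl : LipschitzWith (K * ‖h‖₊) g := by
    apply hv.comp
    refine LipschitzWith.of_dist_le_mul fun s t => ?_
    rw [dist_add_left, dist_eq_norm, ← sub_smul, norm_smul, dist_eq_norm, mul_comm]
    rfl
  have hac : AbsolutelyContinuousOnInterval g 0 1 :=
    (hgl.lipschitzOnWith (s := uIcc 0 1)).absolutelyContinuousOnInterval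
  have hftc := hac.integral_deriv_eq_sub
  have e : v (x + h) - v x = ∫ t in Ioc (0:ℝ) 1, deriv g t := by
    rw [← intervalIntegral.integral_of_le zero_le_one, hftc]
    simp [hg]
  rw [e]
  refine (enorm_integral_le_lintegral_enorm _).trans ?_
  refine lintegral_mono_ae (ae_restrict_of_ae ?_)
  filter_upwards [hx] with t ht
  have hd : HasDerivAt g (fderiv ℝ v (x + t • h) h) t := by
    have h2 : HasDerivAt (fun t : ℝ => x + t • h) h t := by
      simpa using ((hasDerivAt_id t).smul_const h).const_add x
    exact ht.hasFDerivAt.comp_hasDerivAt t h2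
  rw [hd.deriv]
  exact ContinuousLinearMap.le_opENorm _ _

lemma aux_A {d : ℕ} (v : EuclideanSpace ℝ (Fin d) → ℝ) {K : NNReal} (hv : LipschitzWith K v)
    (B : Set (EuclideanSpace ℝ (Fin d))) (hB : Convex ℝ B) (hBm : MeasurableSet B)
    (h : EuclideanSpace ℝ (Fin d)) :
    ∫⁻ x, (B.indicator 1 x * B.indicator 1 (x + h)) * ‖v (x + h) - v x‖ₑ ≤
      ‖h‖ₑ * ∫⁻ x in B, ‖fderiv ℝ v x‖ₑ := by
  set G : EuclideanSpace ℝ (Fin d) → ENNReal := B.indicator (fun x => ‖fderiv ℝ v x‖ₑ) with hG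
  have hGm : Measurable G := ((measurable_fderiv ℝ v).enorm).indicator hBm
  calc _ ≤ ∫⁻ x, ∫⁻ t in Ioc (0:ℝ) 1, G (x + t • h) * ‖h‖ₑ := by
        refine lintegral_mono_ae ?_
        filter_upwards [aux_line v hv h] with x hx
        by_cases h1 : x ∈ B
        · by_cases h2 : x + h ∈ B
          · simp only [h1, h2, indicator_of_mem, Pi.one_apply, one_mul]
            refine hx.trans (setLIntegral_mono' measurableSet_Ioc fun t ht => ?_)
            have : x + t • h ∈ B := by
              exact hB.add_smul_mem h1 h2 ⟨ht.1.le, ht.2⟩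
            simp [hG, this]
          · simp [h2]
        · simp [h1]
    _ = ∫⁻ t in Ioc (0:ℝ) 1, ∫⁻ x, G (x + t • h) * ‖h‖ₑ := by
        rw [lintegral_lintegral_swap]
        apply Measurable.aemeasurable
        unfold Function.uncurry
        fun_prop
    _ = ∫⁻ t in Ioc (0:ℝ) 1, (∫⁻ x, G x) * ‖h‖ₑ := by
        congr 1; ext t
        rw [lintegral_add_right_eq_self (fun x => G x * ‖h‖ₑ), lintegral_mul_const _ hGm]
    _ = _ := by
        simp [hG, lintegral_indicator hBm, mul_comm]

noncomputable def auxf (d : ℕ) (p L r : ℝ) : ℝ :=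
  (Iio (1/L)).indicator (fun r => L^(p-1) * r^(p-1) * (r^d)⁻¹) r +
  (Ico (1/L) 2).indicator (fun r => 2^(p-1) * (r^d)⁻¹) r

lemma auxf_meas (d : ℕ) (p L : ℝ) : Measurable (auxf d p L) := by
  unfold auxf
  exact ((by fun_prop : Measurable (fun r : ℝ => L^(p-1) * r^(p-1) * (r^d)⁻¹)).indicator
    measurableSet_Iio).add
    ((by fun_prop : Measurable (fun r : ℝ => 2^(p-1) * (r^d)⁻¹)).indicator measurableSet_Ico)

lemma aux_B (d : ℕ) (hd : 1 ≤ d) (p : ℝ) (hp : 1 < p) (L : ℝ) (hL : 2 ≤ L) :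
    ∫⁻ h : EuclideanSpace ℝ (Fin d), ENNReal.ofReal (auxf d p L ‖h‖) ≤
      ENNReal.ofReal ((d * volume.real (ball (0 : EuclideanSpace ℝ (Fin d)) 1) *
        (1 / ((p - 1) * Real.log 2) + 2 ^ (p - 1) * 2)) * Real.log L) := by
  have : Nonempty (Fin d) := ⟨⟨0, hd⟩⟩
  have hL0 : 0 < L := by linarith
  have hL2 : 1 / L < 2 := by rw [div_lt_iff₀ hL0]; linarith
  have hLp : 0 < 1 / L := by positivity
  have hid : ∀ y : ℝ, 0 < y → y ^ (d - 1) * (y ^ d)⁻¹ = y⁻¹ := by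
    intro y hy
    obtain ⟨k, rfl⟩ : ∃ k, d = k + 1 := ⟨d - 1, by omega⟩
    simp only [Nat.add_sub_cancel]
    field_simp
    ring
  have hEq : EqOn (fun y : ℝ => y ^ (d - 1) • auxf d p L y)
      (fun y => (Ioo 0 (1/L)).indicator (fun r => L^(p-1) * r^(p-2)) y +
        (Ico (1/L) 2).indicator (fun r => 2^(p-1) * r⁻¹) y) (Ioi 0) := by
    intro y hy
    have hy : 0 < y := hy
    simp only [auxf, smul_eq_mul, indicator, mem_Iio, mem_Ico, mem_Ioo, hy, true_and, mul_add]
    congr 1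
    · split_ifs
      · have : y ^ (p - 2) = y ^ (p - 1) * y⁻¹ := by
          rw [← Real.rpow_neg_one, ← Real.rpow_add hy]; ring_nf
        rw [this, ← hid y hy]; ring
      · simp
    · split_ifs
      · rw [← hid y hy]; ring
      · simp
  have i1 : IntegrableOn (fun r : ℝ => L^(p-1) * r^(p-2)) (Ioo 0 (1/L)) := by
    refine Integrable.const_mul ?_ _
    exact (intervalIntegral.integrableOn_Ioo_rpow_iff hLp).2 (by linarith)
  have i2 : IntegrableOn (fun r : ℝ => 2^(p-1) * r⁻¹) (Ico (1/L) 2) := by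
    refine Integrable.const_mul ?_ _
    refine (ContinuousOn.integrableOn_Icc ?_).mono_set Ico_subset_Icc_self
    intro x hx
    exact (continuousAt_inv₀ (by linarith [hx.1])).continuousWithinAt
  have j1 : IntegrableOn ((Ioo 0 (1/L)).indicator (fun r => L^(p-1) * r^(p-2))) (Ioi 0) :=
    ((integrable_indicator_iff measurableSet_Ioo).2 i1).integrableOn
  have j2 : IntegrableOn ((Ico (1/L) 2).indicator (fun r => 2^(p-1) * r⁻¹)) (Ioi 0) :=
    ((integrable_indicator_iff measurableSet_Ico).2 i2).integrableOn
  have hint : Integrable (fun h : EuclideanSpace ℝ (Fin d) => auxf d p L ‖h‖) := by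
    rw [integrable_fun_norm_addHaar volume (f := auxf d p L)]
    simp only [finrank_euclideanSpace, Fintype.card_fin]
    rw [integrableOn_congr_fun hEq measurableSet_Ioi]
    exact j1.add j2
  have hnn : ∀ h : EuclideanSpace ℝ (Fin d), 0 ≤ auxf d p L ‖h‖ := by
    intro h
    unfold auxf
    simp only [indicator]
    apply add_nonneg <;> split_ifs <;> positivity
  rw [← ofReal_integral_eq_lintegral_ofReal hint (Filter.Eventually.of_forall hnn)]
  apply ENNReal.ofReal_le_ofReal
  rw [integral_fun_norm_addHaar volume (auxf d p L)]
  simp only [finrank_euclideanSpace, Fintype.card_fin]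
  have hsub : Ico (1/L) 2 ⊆ Ioi (0:ℝ) := fun x hx => lt_of_lt_of_le hLp hx.1
  rw [setIntegral_congr_fun measurableSet_Ioi hEq, integral_add j1 j2,
    setIntegral_indicator measurableSet_Ioo, setIntegral_indicator measurableSet_Ico,
    inter_eq_right.2 (Ioo_subset_Ioi_self), 
    inter_eq_right.2 hsub, integral_const_mul, integral_const_mul,
    ← integral_Ioc_eq_integral_Ioo, integral_Ico_eq_integral_Ioo, ← integral_Ioc_eq_integral_Ioo,
    ← intervalIntegral.integral_of_le hLp.le, ← intervalIntegral.integral_of_le hL2.le,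
    integral_rpow (Or.inl (by linarith)), integral_inv_of_pos hLp (by norm_num)]
  have e1 : L ^ (p - 1) * (((1 / L) ^ (p - 2 + 1) - 0 ^ (p - 2 + 1)) / (p - 2 + 1)) = 1 / (p - 1) := by
    have : p - 2 + 1 = p - 1 := by ring
    rw [this, Real.zero_rpow (by linarith), sub_zero, mul_div_assoc',
      ← Real.mul_rpow hL0.le hLp.le, mul_one_div_cancel hL0.ne', Real.one_rpow]
  rw [e1, nsmul_eq_mul, smul_eq_mul, ← mul_assoc, mul_assoc _ _ (Real.log L)]
  have hl2 : 0 < Real.log 2 := Real.log_pos (by norm_num)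
  have hll : Real.log 2 ≤ Real.log L := Real.log_le_log (by norm_num) hL
  have e2 : Real.log (2 / (1 / L)) = Real.log 2 + Real.log L := by
    rw [← Real.log_mul (by norm_num) hL0.ne']; congr 1; field_simp
  rw [e2]
  refine mul_le_mul_of_nonneg_left ?_ (by positivity)
  rw [add_mul]
  apply add_le_add
  · have : 0 < p - 1 := by linarith
    rw [div_mul_eq_mul_div, one_mul, div_le_div_iff₀ this (by positivity)]
    nlinarith
  · rw [mul_assoc]
    refine mul_le_mul_of_nonneg_left ?_ (by positivity)
    linarith

lemma aux_pt (d : ℕ) (p : ℝ) (hp : 1 < p) (L : ℝ) (hL : 2 ≤ L) (a r : ℝ) (ha : 0 ≤ a)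
    (hr : 0 < r) (hr2 : r < 2) (ha2 : a ≤ 2) (haL : a ≤ L * r) :
    a ^ p / r ^ ((d : ℝ) + 1) ≤ a * (auxf d p L r / r) := by
  have hL0 : 0 < L := by linarith
  have e1 : a ^ p = a * a ^ (p - 1) := by
    rcases ha.eq_or_lt with h | h
    · rw [← h, Real.zero_rpow (by linarith)]; simp
    · nth_rw 2 [← Real.rpow_one a]
      rw [← Real.rpow_add h]; ring_nf
  have e2 : r ^ ((d : ℝ) + 1) = r ^ d * r := by
    rw [Real.rpow_add hr, Real.rpow_one, Real.rpow_natCast]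
  rw [e1, e2, mul_div_assoc, ← div_div]
  refine mul_le_mul_of_nonneg_left ?_ ha
  refine div_le_div_of_nonneg_right ?_ hr.le
  rw [div_eq_mul_inv]
  by_cases h : r < 1 / L
  · have h' : ¬ (1 / L ≤ r) := not_le.2 h
    simp only [auxf, indicator, mem_Iio, mem_Ico, h, h', if_true, false_and, if_false, add_zero]
    rw [← Real.mul_rpow hL0.le hr.le]
    gcongr
  · have h' : 1 / L ≤ r := not_lt.1 h
    simp only [auxf, indicator, mem_Iio, mem_Ico, h, h', if_true, true_and, if_false, zero_add, hr2]
    gcongr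

theorem stmt1 (d : ℕ) (hd : 1 ≤ d) (p : ℝ) (hp : 1 < p) :
    ∃ C : ℝ, 0 < C ∧ ∀ L₀ : ℝ, 2 ≤ L₀ →
      ∀ u : EuclideanSpace ℝ (Fin d) → ℝ,
        LipschitzOnWith (Real.toNNReal L₀) u (ball (0 : EuclideanSpace ℝ (Fin d)) 1) →
        (∀ x ∈ ball (0 : EuclideanSpace ℝ (Fin d)) 1, |u x| ≤ 1) →
        (∀ᵐ x ∂(volume.restrict (ball (0 : EuclideanSpace ℝ (Fin d)) 1)),
          ‖fderiv ℝ u x‖ ≤ L₀) →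
        (∫⁻ q : EuclideanSpace ℝ (Fin d) × EuclideanSpace ℝ (Fin d) in
            (ball (0 : EuclideanSpace ℝ (Fin d)) 1) ×ˢ (ball (0 : EuclideanSpace ℝ (Fin d)) 1),
            ENNReal.ofReal (|u q.1 - u q.2| ^ p / ‖q.1 - q.2‖ ^ ((d : ℝ) + 1))) ≤
          ENNReal.ofReal (C * Real.log L₀ *
            ∫ x in ball (0 : EuclideanSpace ℝ (Fin d)) 1, ‖fderiv ℝ u x‖) := by
  have hl2 : 0 < Real.log 2 := Real.log_pos (by norm_num)
  have hp1 : 0 < p - 1 := by linarith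
  have hvol : 0 < volume.real (ball (0 : EuclideanSpace ℝ (Fin d)) 1) :=
    ENNReal.toReal_pos (measure_ball_pos _ _ one_pos).ne' measure_ball_lt_top.ne
  have hd0 : (0:ℝ) < d := by exact_mod_cast hd
  refine ⟨d * volume.real (ball (0 : EuclideanSpace ℝ (Fin d)) 1) *
        (1 / ((p - 1) * Real.log 2) + 2 ^ (p - 1) * 2), by positivity, ?_⟩
  intro L hL u hu hb hD
  have hL0 : 0 < L := by linarith
  set C := d * volume.real (ball (0 : EuclideanSpace ℝ (Fin d)) 1) *
        (1 / ((p - 1) * Real.log 2) + 2 ^ (p - 1) * 2) with hC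
  have hC0 : 0 < C := by positivity
  have hlogL : 0 < Real.log L := Real.log_pos (by linarith)
  set B := ball (0 : EuclideanSpace ℝ (Fin d)) 1 with hB
  have hBm : MeasurableSet B := measurableSet_ball
  obtain ⟨v, hv, huv⟩ := hu.extend_real
  have hfd : ∀ x ∈ B, fderiv ℝ u x = fderiv ℝ v x := by
    intro x hx
    exact Filter.EventuallyEq.fderiv_eq (huv.eventuallyEq_of_mem (isOpen_ball.mem_nhds hx))
  have hvm : Measurable v := hv.continuous.measurable
  -- gradient integral
  have hgi : Integrable (fun x => ‖fderiv ℝ u x‖) (volume.restrict B) := by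
    have : IsFiniteMeasure (volume.restrict B) := ⟨by simpa [hB] using measure_ball_lt_top⟩
    refine Integrable.of_bound ((measurable_fderiv ℝ u).norm.aestronglyMeasurable) L ?_
    filter_upwards [hD] with x hx
    simpa using hx
  have hgrad : ENNReal.ofReal (∫ x in B, ‖fderiv ℝ u x‖) = ∫⁻ x in B, ‖fderiv ℝ v x‖ₑ := by
    rw [ofReal_integral_eq_lintegral_ofReal hgi (Filter.Eventually.of_forall fun x => norm_nonneg _)]
    refine setLIntegral_congr_fun hBm fun x hx => ?_
    simp only [hfd x hx, ofReal_norm]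
  rw [ENNReal.ofReal_mul (by positivity), hgrad]
  set F : EuclideanSpace ℝ (Fin d) → EuclideanSpace ℝ (Fin d) → ENNReal := fun x y =>
    (B.indicator 1 x * B.indicator 1 y) *
      ENNReal.ofReal (|v x - v y| ^ p / ‖x - y‖ ^ ((d : ℝ) + 1)) with hF
  have hind : Measurable (B.indicator (1 : EuclideanSpace ℝ (Fin d) → ENNReal)) :=
    measurable_one.indicator hBm
  have hFm : Measurable (fun q : EuclideanSpace ℝ (Fin d) × EuclideanSpace ℝ (Fin d) =>
      F q.1 q.2) := by
    simp only [hF]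
    fun_prop
  set k : EuclideanSpace ℝ (Fin d) → ENNReal := fun h => ENNReal.ofReal (auxf d p L ‖h‖ / ‖h‖)
    with hk
  have hfm := auxf_meas d p L
  have hkm : Measurable k := by
    simp only [hk]
    fun_prop
  have hFk : ∀ x h, F x (x + h) ≤
      k h * ((B.indicator 1 x * B.indicator 1 (x + h)) * ‖v (x + h) - v x‖ₑ) := by
    intro x h
    by_cases h1 : x ∈ B
    · by_cases h2 : x + h ∈ B
      · simp only [hF, hk, h1, h2, indicator_of_mem, Pi.one_apply, one_mul]
        by_cases h0 : h = 0
        · simp [h0, Real.zero_rpow (show p ≠ 0 by linarith)]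
        have hr : 0 < ‖h‖ := norm_pos_iff.2 h0
        have hx1 : ‖x‖ < 1 := by simpa [hB] using h1
        have hx2 : ‖x + h‖ < 1 := by simpa [hB] using h2
        have hr2 : ‖h‖ < 2 := by
          have := norm_sub_le (x + h) x
          rw [add_sub_cancel_left] at this
          linarith
        have ha2 : |v x - v (x + h)| ≤ 2 := by
          have a1 := hb x h1
          have a2 := hb _ h2
          rw [huv h1] at a1
          rw [huv h2] at a2
          have := abs_sub (v x) (v (x + h))
          linarith
        have haL : |v x - v (x + h)| ≤ L * ‖h‖ := by
          have := hv.dist_le_mul x (x + h)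
          simpa [Real.dist_eq, dist_eq_norm, hL0.le] using this
        have key := aux_pt d p hp L hL _ _ (abs_nonneg (v x - v (x + h))) hr hr2 ha2 haL
        have e1 : ‖x - (x + h)‖ = ‖h‖ := by simp
        rw [e1]
        refine (ENNReal.ofReal_le_ofReal key).trans ?_
        rw [ENNReal.ofReal_mul (abs_nonneg _), mul_comm, abs_sub_comm, ← Real.norm_eq_abs,
          ofReal_norm]
      · simp [hF, h2]
    · simp [hF, h1]
  calc _ = ∫⁻ q : EuclideanSpace ℝ (Fin d) × EuclideanSpace ℝ (Fin d), F q.1 q.2 := by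
        rw [← lintegral_indicator (hBm.prod hBm)]
        congr 1; ext q
        by_cases h1 : q.1 ∈ B
        · by_cases h2 : q.2 ∈ B
          · simp [hF, h1, h2, indicator, huv h1, huv h2]
          · simp [hF, h2, indicator]
        · simp [hF, h1, indicator]
    _ = ∫⁻ x, ∫⁻ y, F x y := by
        rw [Measure.volume_eq_prod, lintegral_prod _ hFm.aemeasurable]
    _ = ∫⁻ x, ∫⁻ h, F x (x + h) := by
        congr 1; ext x
        rw [lintegral_add_left_eq_self (fun y => F x y)]
    _ = ∫⁻ h, ∫⁻ x, F x (x + h) := by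
        rw [lintegral_lintegral_swap]
        apply Measurable.aemeasurable
        exact hFm.comp (by fun_prop : Measurable
          (fun q : EuclideanSpace ℝ (Fin d) × EuclideanSpace ℝ (Fin d) => (q.1, q.1 + q.2)))
    _ ≤ ∫⁻ h, k h * (‖h‖ₑ * ∫⁻ x in B, ‖fderiv ℝ v x‖ₑ) := by
        refine lintegral_mono fun h => ?_
        refine (lintegral_mono (hFk · h)).trans ?_
        rw [lintegral_const_mul _ (by fun_prop)]
        gcongr
        exact aux_A v hv B (convex_ball _ _) hBm h
    _ ≤ ∫⁻ h : EuclideanSpace ℝ (Fin d), ENNReal.ofReal (auxf d p L ‖h‖) *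
          ∫⁻ x in B, ‖fderiv ℝ v x‖ₑ := by
        refine lintegral_mono fun h => ?_
        simp only [← mul_assoc]
        gcongr
        by_cases h0 : h = 0
        · simp [h0]
        have hr : 0 < ‖h‖ := norm_pos_iff.2 h0
        rw [← ofReal_norm, ← ENNReal.ofReal_mul' hr.le, div_mul_cancel₀ _ hr.ne']
    _ = (∫⁻ h : EuclideanSpace ℝ (Fin d), ENNReal.ofReal (auxf d p L ‖h‖)) *
          ∫⁻ x in B, ‖fderiv ℝ v x‖ₑ := by
        rw [lintegral_mul_const _ (by fun_prop)]
    _ ≤ _ := by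
        gcongr
        exact aux_B d hd p hp L hL
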